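/- Let f : [0,1] → ℝ be twice differentiable with a bounded second derivative and satisfy f(x) > 2 for all x ∈ [0,1]. Then the limit lim_{n→∞} D_n(f)/G(f)^n exists and equals (1/2) · (f(1) + √(f(1)² − 4)) / ((f(0)² − 4)(f(1)² − 4))^{1/4}. -/

import Mathlib

open Filter Topology

/-- The n×n discrete Schrödinger matrix with diagonal f(1/n), …, f(n/n) and −1 on the
first super- and subdiagonals. -/
noncomputable def Tmat (f : ℝ → ℝ) (n : ℕ) : Matrix (Fin n) (Fin n) ℝ :=
  Matrix.of fun i j =>
    if (i : ℕ) = (j : ℕ) then f (((i : ℕ) + 1 : ℝ) / (n : ℝ))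
    else if (i : ℕ) + 1 = (j : ℕ) ∨ (j : ℕ) + 1 = (i : ℕ) then -1 else 0

/-- D_n(f) = det T_n(f). -/
noncomputable def Dn (f : ℝ → ℝ) (n : ℕ) : ℝ := (Tmat f n).det

/-- G(f) = exp ∫₀¹ log((f(x) + √(f(x)² − 4))/2) dx. -/
noncomputable def Gf (f : ℝ → ℝ) : ℝ :=
  Real.exp (∫ x in (0:ℝ)..1, Real.log ((f x + Real.sqrt (f x ^ 2 - 4)) / 2))

/-- The continuant `K_k(a_1, …, a_k)`, the determinant of the tridiagonal matrix with diagonal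
`a_1, …, a_k` and off-diagonal entries `-1`. -/
def continuant (a : ℕ → ℝ) : ℕ → ℝ
  | 0 => 1
  | 1 => a 1
  | k + 2 => a (k + 2) * continuant a (k + 1) - continuant a k

theorem continuant_congr {a b : ℕ → ℝ} {n : ℕ} (h : ∀ k ≤ n, a k = b k) :
    continuant a n = continuant b n := by
  induction n using Nat.twoStepInduction with
  | zero => rfl
  | one => exact h 1 le_rfl
  | more k ih0 ih1 =>
    rw [continuant, continuant, h (k + 2) le_rfl, ih0 fun j hj => h j (by omega),
      ih1 fun j hj => h j (by omega)]

/-- The symmetric tridiagonal matrix with diagonal `b` and off-diagonal entries `-1`. -/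
def tridiag (b : ℕ → ℝ) (k : ℕ) : Matrix (Fin k) (Fin k) ℝ :=
  Matrix.of fun i j =>
    if (i : ℕ) = (j : ℕ) then b i
    else if (i : ℕ) + 1 = (j : ℕ) ∨ (j : ℕ) + 1 = (i : ℕ) then -1 else 0

theorem det_tridiag_add_two (b : ℕ → ℝ) (k : ℕ) :
    (tridiag b (k + 2)).det =
      b 0 * (tridiag (fun i => b (i + 1)) (k + 1)).det -
        (tridiag (fun i => b (i + 2)) k).det := by
  have h0 : (tridiag b (k + 2)).submatrix Fin.succ (Fin.succAbove 0) =
      tridiag (fun i => b (i + 1)) (k + 1) := by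
    ext i j
    simp [tridiag]
  have h1 : ((tridiag b (k + 2)).submatrix Fin.succ (Fin.succAbove 1)).det =
      -(tridiag (fun i => b (i + 2)) k).det := by
    rw [Matrix.det_succ_column_zero, Fin.sum_univ_succ]
    have h2 : ((tridiag b (k + 2)).submatrix Fin.succ (Fin.succAbove 1)).submatrix
        (Fin.succAbove 0) Fin.succ = tridiag (fun i => b (i + 2)) k := by
      ext i j
      have : (Fin.succAbove 1 j.succ : Fin (k + 2)) = j.succ.succ := by
        rw [← Fin.succ_zero_eq_one, Fin.succ_succAbove_succ]; simp
      simp [tridiag, this]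
    rw [h2, Finset.sum_eq_zero]
    · simp [tridiag]
    · intro i _
      simp [tridiag]
  rw [Matrix.det_succ_row_zero, Fin.sum_univ_succ, Fin.sum_univ_succ, h0, Finset.sum_eq_zero]
  · have : (Fin.succ 0 : Fin (k + 2)) = 1 := rfl
    rw [this, h1]
    simp [tridiag]
    ring
  · intro i _
    simp [tridiag]

theorem det_tridiag_rev (a : ℕ → ℝ) (k : ℕ) :
    (tridiag (fun i => a (k - i)) k).det = continuant a k := by
  induction k using Nat.twoStepInduction with
  | zero => simp [continuant]
  | one => simp [continuant, tridiag]
  | more k ih0 ih1 =>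
    rw [det_tridiag_add_two, continuant, ← ih0, ← ih1]
    simp only [Nat.add_sub_add_right, Nat.sub_zero]
    congr 3
    congr 1
    funext i
    congr 1
    omega

theorem Dn_eq_continuant (f : ℝ → ℝ) (n : ℕ) :
    Dn f n = continuant (fun k => f (k / n)) n := by
  rw [← det_tridiag_rev, Dn, ← Matrix.det_submatrix_equiv_self Fin.revPerm]
  congr 1
  ext i j
  have hi := i.isLt
  have hj := j.isLt
  have e1 : (n - (i + 1) = n - (j + 1)) ↔ (i : ℕ) = j := by omega
  have e2 : (n - ((i : ℕ) + 1) + 1 = n - (j + 1) ∨ n - ((j : ℕ) + 1) + 1 = n - (i + 1)) ↔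
      ((i : ℕ) + 1 = j ∨ (j : ℕ) + 1 = i) := by omega
  have e3 : ((n - ((i : ℕ) + 1) : ℕ) : ℝ) + 1 = ((n - (i : ℕ) : ℕ) : ℝ) := by
    norm_cast; omega
  simp only [Tmat, tridiag, Matrix.submatrix_apply, Matrix.of_apply, Fin.revPerm_apply,
    Fin.val_rev, e1, e2, e3]

section Discrete

variable {l : ℕ → ℝ} {μ A h : ℝ} {n : ℕ}

theorem continuant_pos_and_ratio (hμ : 1 < μ) (hl : ∀ k ≤ n, μ ≤ l k)
    (a : ℕ → ℝ) (ha : ∀ k ≤ n, a k = l k + (l k)⁻¹) :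
    ∀ k < n, 0 < continuant a k ∧ μ * continuant a k ≤ continuant a (k + 1) := by
  intro k
  induction k with
  | zero =>
    intro hk
    have := hl 1 hk
    have h1 : 0 < (l 1)⁻¹ := inv_pos.2 (by linarith)
    simp only [continuant, ha 1 hk]
    constructor <;> linarith
  | succ k ih =>
    intro hk
    obtain ⟨h0, h1⟩ := ih (by omega)
    have hp : 0 < continuant a (k + 1) := lt_of_lt_of_le (by positivity) h1
    refine ⟨hp, ?_⟩
    rw [continuant, ha (k + 2) hk]
    have h2 := hl (k + 2) hk
    have hlp : 0 < l (k + 2) := by linarith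
    have h3 : μ + μ⁻¹ ≤ l (k + 2) + (l (k + 2))⁻¹ := by
      have : l (k + 2) + (l (k + 2))⁻¹ - (μ + μ⁻¹)
          = (l (k + 2) - μ) * (μ * l (k + 2) - 1) / (μ * l (k + 2)) := by
        field_simp
        ring
      have h4 : 0 ≤ (l (k + 2) - μ) * (μ * l (k + 2) - 1) / (μ * l (k + 2)) := by
        apply div_nonneg _ (by positivity)
        apply mul_nonneg <;> nlinarith
      linarith
    have h4 : continuant a k ≤ μ⁻¹ * continuant a (k + 1) := by
      rw [inv_mul_eq_div, le_div_iff₀ (by positivity)]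
      linarith
    nlinarith

theorem abs_ratio_sub_le (hμ : 1 < μ) (hl : ∀ k ≤ n, μ ≤ l k) (hA : 0 ≤ A * h)
    (hlip : ∀ k < n, |l (k + 1) - l k| ≤ A * h)
    (a : ℕ → ℝ) (ha : ∀ k ≤ n, a k = l k + (l k)⁻¹) :
    ∀ k < n, |continuant a (k + 1) / continuant a k - l (k + 1)| ≤
      μ⁻¹ ^ k + A * h / (μ - 1) := by
  have hr := continuant_pos_and_ratio hμ hl a ha
  have hB : 0 ≤ A * h / (μ - 1) := div_nonneg hA (by linarith)
  intro k
  induction k with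
  | zero =>
    intro hk
    have := hl 1 hk
    have h1 : (l 1)⁻¹ ≤ 1 := inv_le_one_of_one_le₀ (by linarith)
    have h2 : 0 < (l 1)⁻¹ := inv_pos.2 (by linarith)
    simp only [continuant, ha 1 hk, pow_zero, zero_add, div_one, add_sub_cancel_left]
    rw [abs_of_pos h2]
    linarith
  | succ k ih =>
    intro hk
    have ih := ih (by omega)
    obtain ⟨p0, r0⟩ := hr k (by omega)
    obtain ⟨p1, -⟩ := hr (k + 1) hk
    set r := continuant a (k + 1) / continuant a k with hrdef
    have hrμ : μ ≤ r := by rw [hrdef, le_div_iff₀ p0]; exact r0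
    have hr0 : 0 < r := by linarith
    have h2 := hl (k + 2) hk
    have hlp : 0 < l (k + 2) := by linarith
    have e : continuant a (k + 2) / continuant a (k + 1) - l (k + 2)
        = ((r - l (k + 1)) - (l (k + 2) - l (k + 1))) / (l (k + 2) * r) := by
      have : continuant a (k + 2) / continuant a (k + 1) = l (k + 2) + (l (k + 2))⁻¹ - r⁻¹ := by
        rw [continuant, ha (k + 2) hk, hrdef]
        field_simp
      rw [this]
      field_simp
      ring
    rw [e, abs_div, abs_of_pos (mul_pos hlp hr0)]
    have h3 := hlip (k + 1) hk
    have h4 := abs_sub (r - l (k + 1)) (l (k + 2) - l (k + 1))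
    have h5 : μ ≤ l (k + 2) * r := by nlinarith
    have h6 : |r - l (k + 1) - (l (k + 2) - l (k + 1))| ≤
        μ⁻¹ ^ k + A * h / (μ - 1) + A * h := by
      linarith
    rw [div_le_iff₀ (by positivity)]
    have hne : μ - 1 ≠ 0 := by linarith
    have h7 : μ⁻¹ ^ k + A * h / (μ - 1) + A * h =
        (μ⁻¹ ^ (k + 1) + A * h / (μ - 1)) * μ := by
      have : μ ≠ 0 := by positivity
      rw [pow_succ]
      field_simp
      ring
    rw [h7] at h6
    refine h6.trans ?_
    gcongr

theorem continuant_div_prod_le (hμ : 1 < μ) (hl : ∀ k ≤ n, μ ≤ l k) (hA : 0 ≤ A * h)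
    (hlip : ∀ k < n, |l (k + 1) - l k| ≤ A * h) (hnh : n * h ≤ 1) (hA0 : 0 ≤ A)
    (a : ℕ → ℝ) (ha : ∀ k ≤ n, a k = l k + (l k)⁻¹) (k : ℕ) (hk : k < n) :
    continuant a k / ∏ j ∈ Finset.range k, l (j + 1) ≤
      Real.exp ((1 - μ⁻¹)⁻¹ + A / (μ - 1)) := by
  have hr := continuant_pos_and_ratio hμ hl a ha
  have hε := abs_ratio_sub_le hμ hl hA hlip a ha
  have key : ∀ k ≤ n - 1, continuant a k / ∏ j ∈ Finset.range k, l (j + 1) ≤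
      Real.exp (∑ j ∈ Finset.range k, (μ⁻¹ ^ j + A * h / (μ - 1))) := by
    intro k
    induction k with
    | zero => simp [continuant]
    | succ k ih =>
      intro hk
      have ih := ih (by omega)
      obtain ⟨p0, -⟩ := hr k (by omega)
      have hε := hε k (by omega)
      have h2 := hl (k + 1) (by omega)
      have hlp : 0 < l (k + 1) := by linarith
      have hprod : 0 < ∏ j ∈ Finset.range k, l (j + 1) :=
        Finset.prod_pos fun j hj => by
          have := hl (j + 1) (by have := Finset.mem_range.1 hj; omega)
          linarith
      have e : continuant a (k + 1) / ∏ j ∈ Finset.range (k + 1), l (j + 1) =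
          (continuant a k / ∏ j ∈ Finset.range k, l (j + 1)) *
            (continuant a (k + 1) / continuant a k / l (k + 1)) := by
        rw [Finset.prod_range_succ]
        field_simp
      rw [e, Finset.sum_range_succ, Real.exp_add]
      have hx := Real.add_one_le_exp (μ⁻¹ ^ k + A * h / (μ - 1))
      have hy : continuant a (k + 1) / continuant a k / l (k + 1) ≤
          Real.exp (μ⁻¹ ^ k + A * h / (μ - 1)) := by
        refine le_trans ?_ hx
        rw [div_le_iff₀ hlp]
        have := (abs_le.1 hε).2
        have := (abs_nonneg _).trans hε
        nlinarith
      obtain ⟨p1, -⟩ := hr (k + 1) (by omega)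
      exact mul_le_mul ih hy (by positivity) (by positivity)
  refine (key k (by omega)).trans (Real.exp_le_exp.2 ?_)
  rw [Finset.sum_add_distrib, Finset.sum_const, Finset.card_range, nsmul_eq_mul]
  have hi0 : 0 ≤ μ⁻¹ := by positivity
  have hi1 : μ⁻¹ < 1 := inv_lt_one_of_one_lt₀ hμ
  have h1 : ∑ j ∈ Finset.range k, μ⁻¹ ^ j ≤ (1 - μ⁻¹)⁻¹ := by
    rw [← tsum_geometric_of_lt_one hi0 hi1]
    exact (summable_geometric_of_lt_one hi0 hi1).sum_le_tsum _ fun _ _ => by positivity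
  have h2 : (k : ℝ) * (A * h / (μ - 1)) ≤ A / (μ - 1) := by
    have hkn : (k : ℝ) ≤ n := by exact_mod_cast hk.le
    rw [← mul_div_assoc]
    apply div_le_div_of_nonneg_right _ (by linarith)
    calc (k : ℝ) * (A * h) ≤ n * (A * h) := by gcongr
      _ = A * (n * h) := by ring
      _ ≤ A * 1 := by gcongr
      _ = A := mul_one A
  linarith

theorem continuant_wronskian (hμ : 1 < μ) (hl : ∀ k ≤ n, μ ≤ l k) {V τ : ℝ}
    (a : ℕ → ℝ) (ha : ∀ k ≤ n, a k = l k + (l k)⁻¹) (c v : ℕ → ℝ)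
    (hv : ∀ k, v k = continuant a k / ∏ j ∈ Finset.range k, l (j + 1))
    (hV : ∀ k < n, v k ≤ V)
    (hc : ∀ k, k + 1 < n → |(l (k + 2) + (l (k + 2))⁻¹) * c (k + 1) - c (k + 2) / l (k + 2)
      - l (k + 1) * c k| ≤ τ) (k : ℕ) (hk : k < n) :
    |(v (k + 1) * l (k + 1) * c k - v k * c (k + 1) / l (k + 1)) -
      ((l 1 + (l 1)⁻¹) * c 0 - c 1 / l 1)| ≤ k * (V * τ) := by
  have hr := continuant_pos_and_ratio hμ hl a ha
  have hlp : ∀ k ≤ n, 0 < l k := fun k hk => by linarith [hl k hk]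
  induction k with
  | zero =>
    have := hlp 1 hk
    have e : (v 1 * l 1 * c 0 - v 0 * c 1 / l 1) = (l 1 + (l 1)⁻¹) * c 0 - c 1 / l 1 := by
      have : (l 1 + (l 1)⁻¹) / l 1 * l 1 = l 1 + (l 1)⁻¹ := div_mul_cancel₀ _ this.ne'
      simp [hv, continuant, ha 1 hk, this]
    simp only [zero_add, e]
    simp
  | succ k ih =>
    have ih := ih (by omega)
    have hprod : 0 < ∏ j ∈ Finset.range k, l (j + 1) :=
      Finset.prod_pos fun j hj => hlp _ (by have := Finset.mem_range.1 hj; omega)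
    have p1 := hlp (k + 1) (by omega)
    have p2 := hlp (k + 2) (by omega)
    have e : (v (k + 2) * l (k + 2) * c (k + 1) - v (k + 1) * c (k + 2) / l (k + 2)) -
        (v (k + 1) * l (k + 1) * c k - v k * c (k + 1) / l (k + 1)) =
        v (k + 1) * ((l (k + 2) + (l (k + 2))⁻¹) * c (k + 1) - c (k + 2) / l (k + 2)
          - l (k + 1) * c k) := by
      simp only [hv, Finset.prod_range_succ, continuant, ha (k + 2) hk]
      field_simp
      ring
    have hvp : 0 ≤ v (k + 1) := by
      rw [hv]
      refine div_nonneg (hr (k + 1) hk).1.le (Finset.prod_nonneg fun j hj => ?_)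
      exact (hlp _ (by have := Finset.mem_range.1 hj; omega)).le
    have h1 : |v (k + 1) * ((l (k + 2) + (l (k + 2))⁻¹) * c (k + 1) - c (k + 2) / l (k + 2)
          - l (k + 1) * c k)| ≤ V * τ := by
      rw [abs_mul, abs_of_nonneg hvp]
      exact mul_le_mul (hV _ hk) (hc k hk) (abs_nonneg _) (hvp.trans (hV _ hk))
    rw [← e] at h1
    have h2 := abs_sub_le (v (k + 2) * l (k + 2) * c (k + 1) - v (k + 1) * c (k + 2) / l (k + 2))
      (v (k + 1) * l (k + 1) * c k - v k * c (k + 1) / l (k + 1))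
      ((l 1 + (l 1)⁻¹) * c 0 - c 1 / l 1)
    push_cast
    linarith

end Discrete

/-- `φ` is approximated on `[0, 1]` by its first-order expansion with slope `φ'`, up to a
quadratic error with constant `K`. -/
def QuadApprox (φ φ' : ℝ → ℝ) (K : ℝ) : Prop :=
  ∀ x ∈ Set.Icc (0 : ℝ) 1, ∀ y ∈ Set.Icc (0 : ℝ) 1,
    |φ y - φ x - φ' x * (y - x)| ≤ K * (y - x) ^ 2

theorem quadApprox_of_hasDerivWithinAt {φ φ' φ'' : ℝ → ℝ} {M : ℝ}
    (h1 : ∀ x ∈ Set.Icc (0 : ℝ) 1, HasDerivWithinAt φ (φ' x) (Set.Icc (0 : ℝ) 1) x)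
    (h2 : ∀ x ∈ Set.Icc (0 : ℝ) 1, HasDerivWithinAt φ' (φ'' x) (Set.Icc (0 : ℝ) 1) x)
    (hM : ∀ x ∈ Set.Icc (0 : ℝ) 1, |φ'' x| ≤ M) : QuadApprox φ φ' M := by
  intro x hx y hy
  have hM0 : 0 ≤ M := (abs_nonneg _).trans (hM x hx)
  have hsub : Set.uIcc x y ⊆ Set.Icc (0 : ℝ) 1 := Set.uIcc_subset_Icc hx hy
  have hlip : ∀ t ∈ Set.uIcc x y, ‖φ' t - φ' x‖ ≤ M * |y - x| := by
    intro t ht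
    have := (convex_Icc (0 : ℝ) 1).norm_image_sub_le_of_norm_hasDerivWithin_le h2 hM hx (hsub ht)
    refine this.trans ?_
    rw [Real.norm_eq_abs]
    exact mul_le_mul_of_nonneg_left (Set.abs_sub_left_of_mem_uIcc ht) hM0
  have hg : ∀ t ∈ Set.uIcc x y,
      HasDerivWithinAt (fun t => φ t - φ x - φ' x * (t - x)) (φ' t - φ' x) (Set.uIcc x y) t := by
    intro t ht
    have := (((h1 t (hsub ht)).mono hsub).sub_const (φ x)).fun_sub
      (((hasDerivWithinAt_id t (Set.uIcc x y)).sub_const x).const_mul (φ' x))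
    simpa using this
  have := (convex_uIcc x y).norm_image_sub_le_of_norm_hasDerivWithin_le hg hlip
    Set.left_mem_uIcc Set.right_mem_uIcc
  simp only [Real.norm_eq_abs, sub_self, mul_zero, sub_zero] at this
  calc _ ≤ _ := this
    _ = M * (|y - x| * |y - x|) := by ring
    _ = M * (y - x) ^ 2 := by rw [abs_mul_abs_self]; ring

theorem exists_quadApprox_comp {f f' f'' Φ : ℝ → ℝ} {M : ℝ}
    (hd1 : ∀ x ∈ Set.Icc (0 : ℝ) 1, HasDerivWithinAt f (f' x) (Set.Icc (0 : ℝ) 1) x)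
    (hd2 : ∀ x ∈ Set.Icc (0 : ℝ) 1, HasDerivWithinAt f' (f'' x) (Set.Icc (0 : ℝ) 1) x)
    (hbd : ∀ x ∈ Set.Icc (0 : ℝ) 1, |f'' x| ≤ M)
    (hf2 : ∀ x ∈ Set.Icc (0 : ℝ) 1, 2 < f x) (hΦ : ContDiffOn ℝ 2 Φ (Set.Ioi 2)) :
    ContinuousOn (fun x => Φ (f x)) (Set.Icc 0 1) ∧
    ContinuousOn (fun x => deriv Φ (f x) * f' x) (Set.Icc 0 1) ∧
    ∃ K, QuadApprox (fun x => Φ (f x)) (fun x => deriv Φ (f x) * f' x) K := by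
  have hfc : ContinuousOn f (Set.Icc 0 1) := fun x hx => (hd1 x hx).continuousWithinAt
  have hf'c : ContinuousOn f' (Set.Icc 0 1) := fun x hx => (hd2 x hx).continuousWithinAt
  have hm : Set.MapsTo f (Set.Icc 0 1) (Set.Ioi 2) := hf2
  have hΦ1 : ContDiffOn ℝ 1 (deriv Φ) (Set.Ioi 2) :=
    hΦ.deriv_of_isOpen isOpen_Ioi (by norm_num)
  have hΦ2 : ContinuousOn (deriv (deriv Φ)) (Set.Ioi 2) :=
    (hΦ1.deriv_of_isOpen (m := 0) isOpen_Ioi (by norm_num)).continuousOn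
  have hD : ∀ z ∈ Set.Ioi (2 : ℝ), HasDerivAt Φ (deriv Φ z) z := fun z hz =>
    ((hΦ.differentiableOn (by norm_num)).differentiableAt (isOpen_Ioi.mem_nhds hz)).hasDerivAt
  have hD1 : ∀ z ∈ Set.Ioi (2 : ℝ), HasDerivAt (deriv Φ) (deriv (deriv Φ) z) z := fun z hz =>
    ((hΦ1.differentiableOn (by norm_num)).differentiableAt (isOpen_Ioi.mem_nhds hz)).hasDerivAt
  have c1 : ContinuousOn (fun x => deriv Φ (f x)) (Set.Icc 0 1) := hΦ1.continuousOn.comp hfc hm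
  have c2 : ContinuousOn (fun x => deriv (deriv Φ) (f x)) (Set.Icc 0 1) := hΦ2.comp hfc hm
  refine ⟨hΦ.continuousOn.comp hfc hm, c1.mul hf'c, ?_⟩
  obtain ⟨B1, hB1⟩ := isCompact_Icc.exists_bound_of_continuousOn c1
  obtain ⟨B2, hB2⟩ := isCompact_Icc.exists_bound_of_continuousOn ((c2.mul hf'c).mul hf'c)
  refine ⟨B2 + B1 * M, quadApprox_of_hasDerivWithinAt
    (φ'' := fun x => deriv (deriv Φ) (f x) * f' x * f' x + deriv Φ (f x) * f'' x) ?_ ?_ ?_⟩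
  · exact fun x hx => (hD _ (hf2 x hx)).comp_hasDerivWithinAt x (hd1 x hx)
  · exact fun x hx =>
      ((hD1 _ (hf2 x hx)).comp_hasDerivWithinAt x (hd1 x hx)).mul (hd2 x hx)
  · intro x hx
    refine (abs_add_le _ _).trans (add_le_add (hB2 x hx) ?_)
    rw [abs_mul]
    exact mul_le_mul (hB1 x hx) (hbd x hx) (abs_nonneg _) ((norm_nonneg _).trans (hB1 x hx))

theorem QuadApprox.nonneg {φ φ' : ℝ → ℝ} {K : ℝ} (h : QuadApprox φ φ' K) : 0 ≤ K := by
  have := (abs_nonneg _).trans (h 0 (by simp) 1 (by simp))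
  simpa using this

theorem QuadApprox.abs_integral_sub_le {θ θ' : ℝ → ℝ} {K : ℝ} (h : QuadApprox θ θ' K)
    (hθ : ContinuousOn θ (Set.Icc 0 1)) {p q : ℝ} (hp : 0 ≤ p) (hpq : p ≤ q) (hq : q ≤ 1) :
    |θ q * (q - p) - (∫ t in p..q, θ t) - (θ q - θ p) * (q - p) / 2| ≤ 2 * K * (q - p) ^ 3 := by
  have hqI : q ∈ Set.Icc (0 : ℝ) 1 := ⟨hp.trans hpq, hq⟩
  have hpI : p ∈ Set.Icc (0 : ℝ) 1 := ⟨hp, hpq.trans hq⟩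
  have hK := h.nonneg
  have hi : IntervalIntegrable θ MeasureTheory.volume p q :=
    (hθ.mono (Set.uIcc_subset_Icc hpI hqI)).intervalIntegrable
  have e : (∫ t in p..q, (θ t - (θ q + θ' q * (t - q)))) =
      (∫ t in p..q, θ t) - θ q * (q - p) + θ' q * (q - p) ^ 2 / 2 := by
    rw [intervalIntegral.integral_sub hi (by apply Continuous.intervalIntegrable; fun_prop),
      intervalIntegral.integral_add (by simp) (by apply Continuous.intervalIntegrable; fun_prop)]
    have e' : (∫ t in p..q, (t - q)) = -((q - p) ^ 2 / 2) := by
      rw [intervalIntegral.integral_sub (by simp) (by simp), integral_id,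
        intervalIntegral.integral_const, smul_eq_mul]
      ring
    rw [intervalIntegral.integral_const, smul_eq_mul, intervalIntegral.integral_const_mul, e']
    ring
  have b : ‖∫ t in p..q, (θ t - (θ q + θ' q * (t - q)))‖ ≤ K * (q - p) ^ 2 * |q - p| := by
    apply intervalIntegral.norm_integral_le_of_norm_le_const
    intro t ht
    rw [Set.uIoc_of_le hpq] at ht
    have := h q hqI t ⟨hp.trans ht.1.le, ht.2.trans hq⟩
    rw [Real.norm_eq_abs, ← sub_sub]
    refine this.trans ?_
    apply mul_le_mul_of_nonneg_left _ hK
    nlinarith [ht.1, ht.2]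
  rw [e, abs_of_nonneg (sub_nonneg.2 hpq), Real.norm_eq_abs] at b
  have b2 := h q hqI p hpI
  have hh : 0 ≤ q - p := sub_nonneg.2 hpq
  have e3 : θ q * (q - p) - (∫ t in p..q, θ t) - (θ q - θ p) * (q - p) / 2 =
      -((∫ t in p..q, θ t) - θ q * (q - p) + θ' q * (q - p) ^ 2 / 2) +
        (θ p - θ q - θ' q * (p - q)) * ((q - p) / 2) := by ring
  rw [e3]
  refine (abs_add_le _ _).trans ?_
  rw [abs_neg, abs_mul, abs_of_nonneg (by positivity : 0 ≤ (q - p) / 2)]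
  have b3 : |θ p - θ q - θ' q * (p - q)| * ((q - p) / 2) ≤ K * (p - q) ^ 2 * ((q - p) / 2) := by
    gcongr
  have : 0 ≤ K * (q - p) ^ 3 := by positivity
  nlinarith

theorem QuadApprox.tendsto_sum_sub_integral {θ θ' : ℝ → ℝ} {K : ℝ} (h : QuadApprox θ θ' K)
    (hθ : ContinuousOn θ (Set.Icc 0 1)) :
    Tendsto (fun n : ℕ => ∑ j ∈ Finset.range n, θ (((j + 1 : ℕ) : ℝ) / n) -
      n * ∫ x in (0 : ℝ)..1, θ x) atTop (𝓝 ((θ 1 - θ 0) / 2)) := by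
  have key : ∀ n : ℕ, 0 < n → |(∑ j ∈ Finset.range n, θ (((j + 1 : ℕ) : ℝ) / n) -
      n * ∫ x in (0 : ℝ)..1, θ x) - (θ 1 - θ 0) / 2| ≤ 2 * K * (1 / (n : ℝ)) := by
    intro n hn
    have hn' : (0 : ℝ) < n := by exact_mod_cast hn
    have hmem : ∀ k ≤ n, ((k : ℝ) / n) ∈ Set.Icc (0 : ℝ) 1 := fun k hk =>
      ⟨by positivity, by rw [div_le_one hn']; exact_mod_cast hk⟩
    have s1 : ∑ j ∈ Finset.range n, (∫ x in ((j : ℕ) : ℝ) / n..((j + 1 : ℕ) : ℝ) / n, θ x) =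
        ∫ x in (0 : ℝ)..1, θ x := by
      rw [intervalIntegral.sum_integral_adjacent_intervals (a := fun j : ℕ => (j : ℝ) / n)]
      · simp [hn'.ne']
      · intro k hk
        exact (hθ.mono (Set.uIcc_subset_Icc (hmem k hk.le) (hmem (k + 1) hk))).intervalIntegrable
    have s2 : ∑ j ∈ Finset.range n, (θ (((j + 1 : ℕ) : ℝ) / n) - θ ((j : ℝ) / n)) =
        θ 1 - θ 0 := by
      rw [Finset.sum_range_sub (fun j : ℕ => θ ((j : ℝ) / n))]
      simp [hn'.ne']
    have hstep : ∀ j : ℕ, ((j + 1 : ℕ) : ℝ) / n - (j : ℝ) / n = 1 / n := by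
      intro j; push_cast; ring
    have e : (∑ j ∈ Finset.range n, θ (((j + 1 : ℕ) : ℝ) / n) -
        n * ∫ x in (0 : ℝ)..1, θ x) - (θ 1 - θ 0) / 2 =
        n * ∑ j ∈ Finset.range n, (θ (((j + 1 : ℕ) : ℝ) / n) * (1 / n) -
          (∫ x in ((j : ℕ) : ℝ) / n..((j + 1 : ℕ) : ℝ) / n, θ x) -
          (θ (((j + 1 : ℕ) : ℝ) / n) - θ ((j : ℝ) / n)) * (1 / n) / 2) := by
      rw [Finset.sum_sub_distrib, Finset.sum_sub_distrib, s1, ← Finset.sum_mul,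
        ← Finset.sum_div, ← Finset.sum_mul, s2]
      field_simp
    rw [e, abs_mul, abs_of_pos hn']
    have hb : |∑ j ∈ Finset.range n, (θ (((j + 1 : ℕ) : ℝ) / n) * (1 / n) -
          (∫ x in ((j : ℕ) : ℝ) / n..((j + 1 : ℕ) : ℝ) / n, θ x) -
          (θ (((j + 1 : ℕ) : ℝ) / n) - θ ((j : ℝ) / n)) * (1 / n) / 2)| ≤
        ∑ j ∈ Finset.range n, 2 * K * (1 / (n : ℝ)) ^ 3 := by
      refine (Finset.abs_sum_le_sum_abs _ _).trans (Finset.sum_le_sum fun j hj => ?_)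
      have hj := Finset.mem_range.1 hj
      rw [← hstep j]
      refine h.abs_integral_sub_le hθ (hmem j hj.le).1 ?_ (hmem (j + 1) hj).2
      have : (0 : ℝ) ≤ 1 / n := by positivity
      have := hstep j
      linarith
    rw [Finset.sum_const, Finset.card_range, nsmul_eq_mul] at hb
    calc _ ≤ (n : ℝ) * (n * (2 * K * (1 / (n : ℝ)) ^ 3)) := by gcongr
      _ = 2 * K * (1 / (n : ℝ)) := by field_simp
  rw [tendsto_iff_norm_sub_tendsto_zero]
  have h0 : Tendsto (fun n : ℕ => 2 * K * (1 / (n : ℝ))) atTop (𝓝 0) := by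
    simpa using (tendsto_const_div_atTop_nhds_zero_nat (1 : ℝ)).const_mul (2 * K)
  refine squeeze_zero' (Eventually.of_forall fun _ => norm_nonneg _) ?_ h0
  filter_upwards [eventually_gt_atTop 0] with n hn using key n hn

theorem abs_transport_le {L L' c c' : ℝ → ℝ} {A B KL Kc : ℝ}
    (hL1 : ∀ x ∈ Set.Icc (0 : ℝ) 1, 1 ≤ L x)
    (hLB : ∀ x ∈ Set.Icc (0 : ℝ) 1, |L x| ≤ B) (hcB : ∀ x ∈ Set.Icc (0 : ℝ) 1, |c x| ≤ B)
    (hcB' : ∀ x ∈ Set.Icc (0 : ℝ) 1, |c' x| ≤ B)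
    (hlip : ∀ x ∈ Set.Icc (0 : ℝ) 1, ∀ y ∈ Set.Icc (0 : ℝ) 1, |L y - L x| ≤ A * |y - x|)
    (qL : QuadApprox L L' KL) (qc : QuadApprox c c' Kc)
    (ode : ∀ x ∈ Set.Icc (0 : ℝ) 1, c' x / L x = L' x * c x + L x * c' x)
    {x h : ℝ} (hh : 0 ≤ h) (hx : x ∈ Set.Icc (0 : ℝ) 1) (hxp : x + h ∈ Set.Icc (0 : ℝ) 1)
    (hxm : x - h ∈ Set.Icc (0 : ℝ) 1) :
    |(L (x + h) + (L (x + h))⁻¹) * c x - c (x + h) / L (x + h) - L x * c (x - h)| ≤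
      (Kc + B * A + KL * B + B * Kc) * h ^ 2 := by
  have p0 : 1 ≤ L x := hL1 x hx
  have p1 : 1 ≤ L (x + h) := hL1 _ hxp
  have hp0 : 0 < L x := by linarith
  have hp1 : 0 < L (x + h) := by linarith
  have a1 := qc x hx _ hxp
  have a2 := qL x hx _ hxp
  have a3 := qc x hx _ hxm
  have a4 := hlip x hx _ hxp
  have hB : 0 ≤ B := (abs_nonneg _).trans (hcB x hx)
  simp only [add_sub_cancel_left, sub_sub_cancel_left, neg_sq, abs_of_nonneg hh] at a1 a2 a3 a4
  have e : (L (x + h) + (L (x + h))⁻¹) * c x - c (x + h) / L (x + h) - L x * c (x - h) =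
      -((c (x + h) - c x - c' x * h) / L (x + h)) +
        c' x * h * (L (x + h) - L x) / (L (x + h) * L x) +
        (L (x + h) - L x - L' x * h) * c x - L x * (c (x - h) - c x - c' x * -h) := by
    have : c' x * h * (L (x + h) - L x) / (L (x + h) * L x) =
        h * (c' x / L x) - c' x * h / L (x + h) := by
      field_simp
    rw [this, ode x hx]
    field_simp
    ring
  have b1 : |(c (x + h) - c x - c' x * h) / L (x + h)| ≤ Kc * h ^ 2 := by
    rw [abs_div, abs_of_pos hp1]
    exact (div_le_self (abs_nonneg _) p1).trans a1
  have b2 : |c' x * h * (L (x + h) - L x) / (L (x + h) * L x)| ≤ B * A * h ^ 2 := by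
    rw [abs_div, abs_of_pos (mul_pos hp1 hp0)]
    refine (div_le_self (abs_nonneg _) (by nlinarith)).trans ?_
    rw [abs_mul, abs_mul, abs_of_nonneg hh]
    calc |c' x| * h * |L (x + h) - L x| ≤ B * h * (A * h) := by
          have := hcB' x hx
          gcongr
      _ = B * A * h ^ 2 := by ring
  have b3 : |(L (x + h) - L x - L' x * h) * c x| ≤ KL * B * h ^ 2 := by
    rw [abs_mul]
    calc _ ≤ (KL * h ^ 2) * B :=
          mul_le_mul a2 (hcB x hx) (abs_nonneg _) ((abs_nonneg _).trans a2)
      _ = _ := by ring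
  have b4 : |L x * (c (x - h) - c x - c' x * -h)| ≤ B * Kc * h ^ 2 := by
    rw [abs_mul]
    calc _ ≤ B * (Kc * h ^ 2) := mul_le_mul (hLB x hx) a3 (abs_nonneg _) hB
      _ = _ := by ring
  rw [e]
  rw [abs_le] at *
  constructor <;> linarith

theorem QuadApprox.abs_sub_le {φ φ' : ℝ → ℝ} {K B : ℝ} (h : QuadApprox φ φ' K)
    (hB : ∀ x ∈ Set.Icc (0 : ℝ) 1, |φ' x| ≤ B) :
    ∀ x ∈ Set.Icc (0 : ℝ) 1, ∀ y ∈ Set.Icc (0 : ℝ) 1, |φ y - φ x| ≤ (K + B) * |y - x| := by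
  intro x hx y hy
  have hK := h.nonneg
  have h1 : |y - x| ≤ 1 := abs_le.2 ⟨by linarith [hx.2, hy.1], by linarith [hx.1, hy.2]⟩
  have h2 : K * (y - x) ^ 2 ≤ K * |y - x| := by
    rw [← sq_abs]
    apply mul_le_mul_of_nonneg_left _ hK
    nlinarith [abs_nonneg (y - x)]
  have h3 : |φ' x * (y - x)| ≤ B * |y - x| := by
    rw [abs_mul]
    exact mul_le_mul_of_nonneg_right (hB x hx) (abs_nonneg _)
  have h4 := abs_add_le (φ y - φ x - φ' x * (y - x)) (φ' x * (y - x))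
  have h5 := h x hx y hy
  rw [sub_add_cancel] at h4
  linarith

theorem tendsto_continuant_div_prod {L L' c c' : ℝ → ℝ} {μ KL Kc : ℝ} (hμ : 1 < μ)
    (hLμ : ∀ x ∈ Set.Icc (0 : ℝ) 1, μ ≤ L x)
    (hL : ContinuousOn L (Set.Icc 0 1)) (hL' : ContinuousOn L' (Set.Icc 0 1))
    (hc : ContinuousOn c (Set.Icc 0 1)) (hc' : ContinuousOn c' (Set.Icc 0 1))
    (qL : QuadApprox L L' KL) (qc : QuadApprox c c' Kc)
    (ode : ∀ x ∈ Set.Icc (0 : ℝ) 1, c' x / L x = L' x * c x + L x * c' x) (hc1 : c 1 ≠ 0) :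
    Tendsto (fun n : ℕ => continuant (fun k => L (k / n) + (L (k / n))⁻¹) n /
        ∏ j ∈ Finset.range n, L (((j + 1 : ℕ) : ℝ) / n)) atTop
      (𝓝 (L 0 * c 0 / (c 1 * (L 1 - (L 1)⁻¹)))) := by
  obtain ⟨B1, hB1⟩ := isCompact_Icc.exists_bound_of_continuousOn hL
  obtain ⟨B2, hB2⟩ := isCompact_Icc.exists_bound_of_continuousOn hL'
  obtain ⟨B3, hB3⟩ := isCompact_Icc.exists_bound_of_continuousOn hc
  obtain ⟨B4, hB4⟩ := isCompact_Icc.exists_bound_of_continuousOn hc'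
  set B := max B1 (max B3 B4) with hBdef
  have hlip := qL.abs_sub_le hB2
  set A := KL + B2
  have hA : 0 ≤ A := add_nonneg qL.nonneg ((norm_nonneg _).trans (hB2 0 (by simp)))
  set T := Kc + B * A + KL * B + B * Kc
  set V := Real.exp ((1 - μ⁻¹)⁻¹ + A / (μ - 1))
  have m0 : (0 : ℝ) ∈ Set.Icc (0 : ℝ) 1 := by simp
  have m1 : (1 : ℝ) ∈ Set.Icc (0 : ℝ) 1 := by simp
  have hL0 : 0 < L 0 := by linarith [hLμ 0 m0]
  have hL1 : 1 < L 1 := by linarith [hLμ 1 m1]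
  have hT : 0 ≤ T := by
    have := (abs_nonneg _).trans
      (abs_transport_le (x := 1 / 2) (h := 1 / 2) (A := A) (B := B) (fun x hx => by
        linarith [hLμ x hx]) (fun x hx => (hB1 x hx).trans (by simp [hBdef]))
        (fun x hx => (hB3 x hx).trans (by simp [hBdef]))
        (fun x hx => (hB4 x hx).trans (by simp [hBdef])) hlip qL qc ode (by norm_num)
        ⟨by norm_num, by norm_num⟩ (by norm_num) (by norm_num))
    nlinarith
  set D : ℕ → ℕ → ℝ := fun n => continuant (fun k => L (k / n) + (L (k / n))⁻¹) with hD
  set v : ℕ → ℕ → ℝ := fun n k =>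
    D n k / ∏ j ∈ Finset.range k, L (((j + 1 : ℕ) : ℝ) / n) with hv
  set R : ℕ → ℝ := fun n => D n n / D n (n - 1) with hR
  set Y : ℕ → ℝ := fun n => L 1 * c (((n - 1 : ℕ) : ℝ) / n) - c 1 / R n with hY
  set Z : ℕ → ℝ := fun n => (L (1 / n) + (L (1 / n))⁻¹) * c 0 - c (1 / n) / L (1 / n) with hZ
  have main : ∀ n : ℕ, 0 < n →
      |R n - L 1| ≤ μ⁻¹ ^ (n - 1) + A * (1 / n) / (μ - 1) ∧
      |v n n * Y n - Z n| ≤ V * T * (1 / n) := by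
    intro n hn
    have hn' : (0 : ℝ) < n := by exact_mod_cast hn
    have hmem : ∀ k ≤ n, ((k : ℝ) / n) ∈ Set.Icc (0 : ℝ) 1 := fun k hk =>
      ⟨by positivity, by rw [div_le_one hn']; exact_mod_cast hk⟩
    have hh : (0 : ℝ) ≤ 1 / n := by positivity
    have hstep : ∀ k : ℕ, ((k + 1 : ℕ) : ℝ) / n = (k : ℝ) / n + 1 / n := by
      intro k; push_cast; ring
    have hl : ∀ k ≤ n, μ ≤ L ((k : ℝ) / n) := fun k hk => hLμ _ (hmem k hk)
    have hlipn : ∀ k < n, |L (((k + 1 : ℕ) : ℝ) / n) - L ((k : ℝ) / n)| ≤ A * (1 / n) := by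
      intro k hk
      refine (hlip _ (hmem k hk.le) _ (hmem (k + 1) hk)).trans_eq ?_
      rw [hstep, add_sub_cancel_left, abs_of_nonneg hh]
    have hAh : 0 ≤ A * (1 / (n : ℝ)) := by positivity
    have hr := continuant_pos_and_ratio (l := fun k : ℕ => L ((k : ℝ) / n)) hμ hl _
      (fun _ _ => rfl)
    have h1 := abs_ratio_sub_le (l := fun k : ℕ => L ((k : ℝ) / n)) hμ hl hAh hlipn _
      (fun _ _ => rfl) (n - 1) (by omega)
    have h2 := continuant_div_prod_le (l := fun k : ℕ => L ((k : ℝ) / n)) hμ hl hAh hlipn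
      (by field_simp; rfl) hA _ (fun _ _ => rfl)
    have h3 := continuant_wronskian (l := fun k : ℕ => L ((k : ℝ) / n)) hμ hl (V := V)
      (τ := T * (1 / n) ^ 2) _ (fun _ _ => rfl) (fun k => c ((k : ℝ) / n)) (v n) (fun _ => rfl) h2
      (by
        intro k hk
        have hxm : ((k + 1 : ℕ) : ℝ) / n - 1 / n = (k : ℝ) / n := by rw [hstep]; ring
        have := abs_transport_le (x := ((k + 1 : ℕ) : ℝ) / n) (h := 1 / n) (A := A) (B := B)
          (fun x hx => by linarith [hLμ x hx]) (fun x hx => (hB1 x hx).trans (by simp [hBdef]))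
          (fun x hx => (hB3 x hx).trans (by simp [hBdef]))
          (fun x hx => (hB4 x hx).trans (by simp [hBdef])) hlip qL qc ode hh
          (hmem _ hk.le) (by rw [← hstep]; exact hmem _ hk)
          (by rw [hxm]; exact hmem _ (by omega))
        rw [hxm, ← hstep] at this
        exact this) (n - 1) (by omega)
    have hnn : n - 1 + 1 = n := by omega
    have hdiv : (n : ℝ) / n = 1 := div_self hn'.ne'
    simp only [hnn, hdiv] at h1 h3
    refine ⟨h1, ?_⟩
    have hDp : 0 < D n (n - 1) := (hr (n - 1) (by omega)).1
    have hDn : 0 < D n n := by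
      have := (hr (n - 1) (by omega)).2
      rw [hnn] at this
      exact lt_of_lt_of_le (by positivity) this
    have hprod : (∏ j ∈ Finset.range (n - 1), L (((j + 1 : ℕ) : ℝ) / n)) ≠ 0 :=
      Finset.prod_ne_zero_iff.2 fun j hj => by
        have := hl (j + 1) (by have := Finset.mem_range.1 hj; omega)
        exact (by linarith : 0 < L (((j + 1 : ℕ) : ℝ) / n)).ne'
    have hvn : v n (n - 1) = v n n * (L 1 / R n) := by
      have : ∏ j ∈ Finset.range n, L (((j + 1 : ℕ) : ℝ) / n) =
          (∏ j ∈ Finset.range (n - 1), L (((j + 1 : ℕ) : ℝ) / n)) * L 1 := by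
        conv_lhs => rw [← hnn, Finset.prod_range_succ, hnn, hdiv]
      simp only [hv, hR, this]
      field_simp
    have e : v n n * Y n = v n n * L 1 * c (((n - 1 : ℕ) : ℝ) / n) - v n (n - 1) * c 1 / L 1 := by
      rw [hvn, hY]
      field_simp
    rw [e]
    have h4 : (((n - 1 : ℕ) : ℝ)) * (V * (T * (1 / n) ^ 2)) ≤ V * T * (1 / n) := by
      have : ((n - 1 : ℕ) : ℝ) ≤ n := by exact_mod_cast Nat.sub_le _ _
      calc (((n - 1 : ℕ) : ℝ)) * (V * (T * (1 / n) ^ 2))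
          ≤ (n : ℝ) * (V * (T * (1 / n) ^ 2)) := by gcongr
        _ = _ := by field_simp
    refine le_trans (le_of_eq ?_) (h3.trans h4)
    simp [hZ]
  have t0 : Tendsto (fun n : ℕ => 1 / (n : ℝ)) atTop (𝓝 0) :=
    tendsto_const_div_atTop_nhds_zero_nat 1
  have hR1 : Tendsto R atTop (𝓝 (L 1)) := by
    rw [tendsto_iff_norm_sub_tendsto_zero]
    have hb : Tendsto (fun n : ℕ => μ⁻¹ ^ (n - 1) + A * (1 / (n : ℝ)) / (μ - 1)) atTop (𝓝 0) := by
      have g1 : Tendsto (fun n : ℕ => μ⁻¹ ^ (n - 1)) atTop (𝓝 0) :=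
        (tendsto_pow_atTop_nhds_zero_of_lt_one (by positivity)
          (inv_lt_one_of_one_lt₀ hμ)).comp (tendsto_sub_atTop_nat 1)
      simpa using g1.add ((t0.const_mul A).div_const (μ - 1))
    refine squeeze_zero' (Eventually.of_forall fun _ => norm_nonneg _) ?_ hb
    filter_upwards [eventually_gt_atTop 0] with n hn using (main n hn).1
  have w0 : Tendsto (fun n : ℕ => 1 / (n : ℝ)) atTop (𝓝[Set.Icc 0 1] 0) := by
    refine tendsto_nhdsWithin_iff.2 ⟨t0, ?_⟩
    filter_upwards [eventually_gt_atTop 0] with n hn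
    have hn' : (1 : ℝ) ≤ n := by exact_mod_cast hn
    exact ⟨by positivity, by rw [div_le_one (by linarith)]; exact hn'⟩
  have w1 : Tendsto (fun n : ℕ => ((n - 1 : ℕ) : ℝ) / n) atTop (𝓝[Set.Icc 0 1] 1) := by
    refine tendsto_nhdsWithin_iff.2 ⟨?_, ?_⟩
    · have : Tendsto (fun n : ℕ => 1 - 1 / (n : ℝ)) atTop (𝓝 1) := by
        simpa using t0.const_sub 1
      refine this.congr' ?_
      filter_upwards [eventually_gt_atTop 0] with n hn
      have hn' : (n : ℝ) ≠ 0 := by exact_mod_cast hn.ne'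
      rw [Nat.cast_sub hn, sub_div, div_self hn', Nat.cast_one]
    · refine Eventually.of_forall fun n => ⟨by positivity, ?_⟩
      exact div_le_one_of_le₀ (by exact_mod_cast Nat.sub_le _ _) (by positivity)
  have hY1 : Tendsto Y atTop (𝓝 (c 1 * (L 1 - (L 1)⁻¹))) := by
    have := ((((hc 1 m1).tendsto).comp w1).const_mul (L 1)).sub
      ((tendsto_const_nhds (x := c 1)).div hR1 (by linarith : 0 < L 1).ne')
    refine this.trans_eq ?_
    congr 1
    ring
  have hZ1 : Tendsto Z atTop (𝓝 (L 0 * c 0)) := by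
    have gL := ((hL 0 m0).tendsto).comp w0
    have := ((gL.add (gL.inv₀ hL0.ne')).mul_const (c 0)).sub
      ((((hc 0 m0).tendsto).comp w0).div gL hL0.ne')
    refine this.trans_eq ?_
    congr 1
    ring
  have hdiff : Tendsto (fun n => v n n * Y n - Z n) atTop (𝓝 0) := by
    rw [tendsto_zero_iff_norm_tendsto_zero]
    have hb : Tendsto (fun n : ℕ => V * T * (1 / (n : ℝ))) atTop (𝓝 0) := by
      simpa using t0.const_mul (V * T)
    refine squeeze_zero' (Eventually.of_forall fun _ => norm_nonneg _) ?_ hb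
    filter_upwards [eventually_gt_atTop 0] with n hn using (main n hn).2
  have hne : c 1 * (L 1 - (L 1)⁻¹) ≠ 0 := by
    have : (L 1)⁻¹ < 1 := inv_lt_one_of_one_lt₀ hL1
    exact mul_ne_zero hc1 (by linarith)
  have hfin := (hdiff.add hZ1).div hY1 hne
  rw [zero_add] at hfin
  refine hfin.congr' ?_
  filter_upwards [hY1.eventually_ne hne] with n hn
  simp only [Pi.div_apply, sub_add_cancel]
  exact mul_div_cancel_right₀ _ hn

/-- The larger root of `t + t⁻¹ = z`. -/
noncomputable def charRoot (z : ℝ) : ℝ := (z + Real.sqrt (z ^ 2 - 4)) / 2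

theorem sq_sub_four_pos {z : ℝ} (hz : 2 < z) : 0 < z ^ 2 - 4 := by nlinarith

theorem one_lt_charRoot {z : ℝ} (hz : 2 < z) : 1 < charRoot z := by
  have := Real.sqrt_nonneg (z ^ 2 - 4)
  unfold charRoot
  linarith

theorem inv_charRoot {z : ℝ} (hz : 2 < z) :
    (charRoot z)⁻¹ = (z - Real.sqrt (z ^ 2 - 4)) / 2 := by
  have h := Real.sq_sqrt (sq_sub_four_pos hz).le
  refine inv_eq_of_mul_eq_one_right ?_
  unfold charRoot
  linear_combination -h / 4

theorem charRoot_add_inv {z : ℝ} (hz : 2 < z) : charRoot z + (charRoot z)⁻¹ = z := by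
  rw [inv_charRoot hz, charRoot]
  ring

theorem charRoot_sub_inv {z : ℝ} (hz : 2 < z) :
    charRoot z - (charRoot z)⁻¹ = Real.sqrt (z ^ 2 - 4) := by
  rw [inv_charRoot hz, charRoot]
  ring

theorem charRoot_sq_sub_one {z : ℝ} (hz : 2 < z) :
    charRoot z ^ 2 - 1 = charRoot z * Real.sqrt (z ^ 2 - 4) := by
  have := one_lt_charRoot hz
  rw [← charRoot_sub_inv hz]
  field_simp

theorem charRoot_sq_sub_one_pos {z : ℝ} (hz : 2 < z) : 0 < charRoot z ^ 2 - 1 := by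
  nlinarith [one_lt_charRoot hz]

theorem contDiffOn_charRoot : ContDiffOn ℝ 2 charRoot (Set.Ioi 2) := by
  unfold charRoot
  refine (contDiffOn_id.add (ContDiffOn.sqrt (by fun_prop) fun z hz => ?_)).div_const 2
  exact ne_of_gt (sq_sub_four_pos hz)

/-- The amplitude of the decaying WKB solution. -/
noncomputable def amplitude (z : ℝ) : ℝ := (Real.sqrt (charRoot z ^ 2 - 1))⁻¹

theorem contDiffOn_amplitude : ContDiffOn ℝ 2 amplitude (Set.Ioi 2) := by
  unfold amplitude
  have h := contDiffOn_charRoot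
  refine ContDiffOn.inv (ContDiffOn.sqrt ((h.pow 2).sub contDiffOn_const) fun z hz => ?_)
    fun z hz => ?_
  · exact (charRoot_sq_sub_one_pos hz).ne'
  · exact (Real.sqrt_pos.2 (charRoot_sq_sub_one_pos hz)).ne'

theorem deriv_amplitude_div {z : ℝ} (hz : 2 < z) :
    deriv amplitude z / charRoot z =
      deriv charRoot z * amplitude z + charRoot z * deriv amplitude z := by
  have hl : HasDerivAt charRoot (deriv charRoot z) z :=
    ((contDiffOn_charRoot.differentiableOn (by norm_num)).differentiableAt
      (isOpen_Ioi.mem_nhds hz)).hasDerivAt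
  have hp := charRoot_sq_sub_one_pos hz
  have hs := Real.sqrt_pos.2 hp
  have h2 := Real.sq_sqrt hp.le
  have hd : deriv amplitude z = _ :=
    ((((hl.fun_pow 2).sub_const 1).sqrt hp.ne').fun_inv hs.ne').deriv
  rw [hd, amplitude]
  have := one_lt_charRoot hz
  set w := Real.sqrt (charRoot z ^ 2 - 1)
  field_simp
  norm_num
  linear_combination (-2 * deriv charRoot z * charRoot z) * h2

theorem limit_value_eq {x y : ℝ} (hx : 2 < x) (hy : 2 < y) :
    charRoot x * amplitude x / (amplitude y * (charRoot y - (charRoot y)⁻¹)) *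
      Real.exp ((Real.log (charRoot y) - Real.log (charRoot x)) / 2) =
    (1 / 2) * (y + Real.sqrt (y ^ 2 - 4)) /
      ((x ^ 2 - 4) * (y ^ 2 - 4)) ^ ((1 : ℝ) / 4) := by
  have hsx := Real.sqrt_pos.2 (sq_sub_four_pos hx)
  have hsy := Real.sqrt_pos.2 (sq_sub_four_pos hy)
  have hlx : 0 < charRoot x := by linarith [one_lt_charRoot hx]
  have hly : 0 < charRoot y := by linarith [one_lt_charRoot hy]
  have e1 : Real.exp ((Real.log (charRoot y) - Real.log (charRoot x)) / 2) =
      Real.sqrt (charRoot y) / Real.sqrt (charRoot x) := by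
    rw [sub_div, Real.exp_sub, Real.exp_half, Real.exp_half, Real.exp_log hly, Real.exp_log hlx]
  have e2 : ((x ^ 2 - 4) * (y ^ 2 - 4)) ^ ((1 : ℝ) / 4) =
      Real.sqrt (Real.sqrt (x ^ 2 - 4)) * Real.sqrt (Real.sqrt (y ^ 2 - 4)) := by
    have q : ∀ t : ℝ, 0 ≤ t → t ^ ((1 : ℝ) / 4) = Real.sqrt (Real.sqrt t) := by
      intro t ht
      rw [Real.sqrt_eq_rpow, Real.sqrt_eq_rpow, ← Real.rpow_mul ht]
      norm_num
    rw [Real.mul_rpow (sq_sub_four_pos hx).le (sq_sub_four_pos hy).le,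
      q _ (sq_sub_four_pos hx).le, q _ (sq_sub_four_pos hy).le]
  have e3 : (1 / 2) * (y + Real.sqrt (y ^ 2 - 4)) = charRoot y := by
    rw [charRoot]
    ring
  rw [e1, e2, e3, charRoot_sub_inv hy, amplitude, amplitude, charRoot_sq_sub_one hx,
    charRoot_sq_sub_one hy, Real.sqrt_mul hlx.le, Real.sqrt_mul hly.le]
  have p1 := Real.sqrt_pos.2 hlx
  have p2 := Real.sqrt_pos.2 hly
  have p3 := Real.sqrt_pos.2 hsx
  have p4 := Real.sqrt_pos.2 hsy
  have r1 := Real.sq_sqrt hlx.le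
  have r2 := Real.sq_sqrt hly.le
  have r4 := Real.sq_sqrt hsy.le
  set a := Real.sqrt (charRoot x)
  set b := Real.sqrt (charRoot y)
  set u := Real.sqrt (Real.sqrt (x ^ 2 - 4))
  set w := Real.sqrt (Real.sqrt (y ^ 2 - 4))
  rw [← r1, ← r2, ← r4]
  field_simp

theorem kac_formula (f f' f'' : ℝ → ℝ)
    (hd1 : ∀ x ∈ Set.Icc (0:ℝ) 1, HasDerivWithinAt f (f' x) (Set.Icc (0:ℝ) 1) x)
    (hd2 : ∀ x ∈ Set.Icc (0:ℝ) 1, HasDerivWithinAt f' (f'' x) (Set.Icc (0:ℝ) 1) x)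
    (hbd : ∃ M : ℝ, ∀ x ∈ Set.Icc (0:ℝ) 1, |f'' x| ≤ M)
    (hf2 : ∀ x ∈ Set.Icc (0:ℝ) 1, 2 < f x) :
    Tendsto (fun n : ℕ => Dn f n / (Gf f) ^ n) atTop
      (𝓝 ((1/2) * (f 1 + Real.sqrt (f 1 ^ 2 - 4)) /
          ((f 0 ^ 2 - 4) * (f 1 ^ 2 - 4)) ^ ((1:ℝ)/4))) := by
  obtain ⟨M, hM⟩ := hbd
  have m0 : (0 : ℝ) ∈ Set.Icc (0 : ℝ) 1 := by simp
  have m1 : (1 : ℝ) ∈ Set.Icc (0 : ℝ) 1 := by simp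
  obtain ⟨hL, hL', KL, qL⟩ := exists_quadApprox_comp hd1 hd2 hM hf2 contDiffOn_charRoot
  obtain ⟨hc, hc', Kc, qc⟩ := exists_quadApprox_comp hd1 hd2 hM hf2 contDiffOn_amplitude
  have hlog : ContDiffOn ℝ 2 (fun z => Real.log (charRoot z)) (Set.Ioi 2) :=
    contDiffOn_charRoot.log fun z hz => by linarith [one_lt_charRoot hz]
  obtain ⟨hθ, -, Kθ, qθ⟩ := exists_quadApprox_comp hd1 hd2 hM hf2 hlog
  obtain ⟨x₀, hx₀, hmin⟩ := isCompact_Icc.exists_isMinOn ⟨0, m0⟩ hL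
  have h1 := tendsto_continuant_div_prod (one_lt_charRoot (hf2 x₀ hx₀)) (fun x hx => hmin hx)
    hL hL' hc hc' qL qc
    (fun x hx => by
      have := deriv_amplitude_div (hf2 x hx)
      linear_combination f' x * this)
    (inv_ne_zero (Real.sqrt_pos.2 (charRoot_sq_sub_one_pos (hf2 1 m1))).ne')
  have h2 := (Real.continuous_exp.tendsto _).comp (qθ.tendsto_sum_sub_integral hθ)
  rw [← limit_value_eq (hf2 0 m0) (hf2 1 m1)]
  refine (h1.mul h2).congr' ?_
  filter_upwards [eventually_gt_atTop 0] with n hn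
  have hn' : (0 : ℝ) < n := by exact_mod_cast hn
  have hmem : ∀ k ≤ n, ((k : ℝ) / n) ∈ Set.Icc (0 : ℝ) 1 := fun k hk =>
    ⟨by positivity, by rw [div_le_one hn']; exact_mod_cast hk⟩
  have hpos : ∀ j ∈ Finset.range n, 0 < charRoot (f (((j + 1 : ℕ) : ℝ) / n)) := fun j hj => by
    linarith [one_lt_charRoot (hf2 _ (hmem (j + 1) (Finset.mem_range.1 hj)))]
  have hG : Gf f ^ n = Real.exp (n * ∫ x in (0 : ℝ)..1, Real.log (charRoot (f x))) := by
    rw [Real.exp_nat_mul]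
    rfl
  have hP : Real.exp (∑ j ∈ Finset.range n, Real.log (charRoot (f (((j + 1 : ℕ) : ℝ) / n)))) =
      ∏ j ∈ Finset.range n, charRoot (f (((j + 1 : ℕ) : ℝ) / n)) := by
    rw [Real.exp_sum]
    exact Finset.prod_congr rfl fun j hj => Real.exp_log (hpos j hj)
  have hD : continuant (fun k => charRoot (f (k / n)) + (charRoot (f (k / n)))⁻¹) n = Dn f n := by
    rw [Dn_eq_continuant]
    refine continuant_congr fun k hk => charRoot_add_inv (hf2 _ (hmem k hk))
  rw [Function.comp_apply, Real.exp_sub, hP, hD, hG]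
  have := (Finset.prod_pos hpos).ne'
  field_simp
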